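/- (Energy estimates for negative mass parameter, Fourier formulation.) Let d ≥ 1 and μ < 0, so that ν = (1/2)√(1−4μ) > 1/2 is real; assume additionally ν ∉ ℤ. Then: (a) for every t₀ ≥ 0 there exists C > 0 (depending on t₀, d, μ) such that for all t ≥ t₀ and all measurable g₀, g₁ : ℝ^d → ℂ with ‖g₀‖_{L²} + ‖|ξ|g₀‖_{L²} + ‖g₁‖_{L²} < ∞, one has ‖ |ξ|(E_0(t,t₀,·)g₀ + E_1(t,t₀,·)g₁) ‖_{L²} + ‖ Ė_0(t,t₀,·)g₀ + Ė_1(t,t₀,·)g₁ ‖_{L²} ≤ C (1+t)^{−1/2 + ν} (‖g₀‖_{L²} + ‖|ξ|g₀‖_{L²} + ‖g₁‖_{L²}); and (b) there exists C' > 0 independent of t and t₀ such that for all t ≥ t₀ ≥ 0, ‖ E_0(t,t₀,·)g₀ + E_1(t,t₀,·)g₁ ‖_{L²} ≤ C' (1+t)^{1/2 + ν} (1+t₀)^{1/2 − ν} (‖g₀‖_{L²} + ‖g₁‖_{L²}). -/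

import Mathlib

open MeasureTheory Real Set

noncomputable section

/-- Bessel function of the first kind `J_ν(τ)`, defined by its power series,
using the principal branch of `(τ/2)^(ν+2k)`. -/
def besselJ (ν : ℂ) (τ : ℝ) : ℂ :=
  ∑' k : ℕ, ((-1 : ℂ) ^ k / ((Nat.factorial k : ℂ) * Complex.Gamma (ν + k + 1))) *
    ((τ : ℂ) / 2) ^ (ν + 2 * (k : ℂ))

/-- Bessel function of the second kind (Neumann function) `Y_ν(τ)` for `ν ∉ ℤ`. -/
def besselY (ν : ℂ) (τ : ℝ) : ℂ :=
  (besselJ ν τ * Complex.cos (ν * (π : ℂ)) - besselJ (-ν) τ) / Complex.sin (ν * (π : ℂ))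

/-- The index `ν` associated with the mass parameter `μ`. -/
def nuOf (μ : ℝ) : ℂ :=
  if μ ≤ 1 / 4 then ((Real.sqrt (1 - 4 * μ) / 2 : ℝ) : ℂ)
  else Complex.I * ((Real.sqrt (4 * μ - 1) / 2 : ℝ) : ℂ)

/-- `e₊(t,ξ) = τ^{1/2} J_ν(τ)` with `τ = (1+t) r`, `r = |ξ|`. -/
def ePlus (ν : ℂ) (r t : ℝ) : ℂ :=
  (Real.sqrt ((1 + t) * r) : ℂ) * besselJ ν ((1 + t) * r)

/-- `e₋(t,ξ) = τ^{1/2} Y_ν(τ)` with `τ = (1+t) r`, `r = |ξ|`. -/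
def eMinus (ν : ℂ) (r t : ℝ) : ℂ :=
  (Real.sqrt ((1 + t) * r) : ℂ) * besselY ν ((1 + t) * r)

/-- `ė₊ = ∂ₜ e₊`. -/
def ePlusDot (ν : ℂ) (r t : ℝ) : ℂ := deriv (ePlus ν r) t

/-- `ė₋ = ∂ₜ e₋`. -/
def eMinusDot (ν : ℂ) (r t : ℝ) : ℂ := deriv (eMinus ν r) t

/-- The Fourier multiplier `E₀(t,t₀,ξ)` of the Klein–Gordon propagator. -/
def E0 (ν : ℂ) (r t t₀ : ℝ) : ℂ :=
  (ePlus ν r t * eMinusDot ν r t₀ - ePlusDot ν r t₀ * eMinus ν r t) /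
    (ePlus ν r t₀ * eMinusDot ν r t₀ - ePlusDot ν r t₀ * eMinus ν r t₀)

/-- The Fourier multiplier `E₁(t,t₀,ξ)` of the Klein–Gordon propagator. -/
def E1 (ν : ℂ) (r t t₀ : ℝ) : ℂ :=
  (ePlus ν r t₀ * eMinus ν r t - ePlus ν r t * eMinus ν r t₀) /
    (ePlus ν r t₀ * eMinusDot ν r t₀ - ePlusDot ν r t₀ * eMinus ν r t₀)

/-- `Ė₀ = ∂ₜ E₀` (derivative in the first time variable). -/
def E0dot (ν : ℂ) (r t t₀ : ℝ) : ℂ := deriv (fun s => E0 ν r s t₀) t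

/-- `Ė₁ = ∂ₜ E₁` (derivative in the first time variable). -/
def E1dot (ν : ℂ) (r t t₀ : ℝ) : ℂ := deriv (fun s => E1 ν r s t₀) t

/-- The Neumann function `Y₀(τ)` (logarithmic case `ν = 0`). -/
def besselY0 (τ : ℝ) : ℂ :=
  (2 / (π : ℂ)) * (Complex.log ((τ : ℂ) / 2) + (Real.eulerMascheroniConstant : ℂ)) * besselJ 0 τ +
    (2 / (π : ℂ)) * ∑' k : ℕ,
      ((-1 : ℂ) ^ ((k + 1) + 1) * ((harmonic (k + 1) : ℚ) : ℂ) /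
          ((Nat.factorial (k + 1) : ℂ)) ^ 2) * ((τ : ℂ) / 2) ^ (2 * (k + 1))

/-- `e₋(t,ξ) = τ^{1/2} Y₀(τ)` in the case `μ = 1/4`, `ν = 0`. -/
def eMinusZ (r t : ℝ) : ℂ :=
  (Real.sqrt ((1 + t) * r) : ℂ) * besselY0 ((1 + t) * r)

/-- `ė₋ = ∂ₜ e₋` in the case `μ = 1/4`. -/
def eMinusZDot (r t : ℝ) : ℂ := deriv (eMinusZ r) t

/-- `E₀(t,t₀,ξ)` in the case `μ = 1/4`, `ν = 0`. -/
def E0Z (r t t₀ : ℝ) : ℂ :=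
  (ePlus 0 r t * eMinusZDot r t₀ - ePlusDot 0 r t₀ * eMinusZ r t) /
    (ePlus 0 r t₀ * eMinusZDot r t₀ - ePlusDot 0 r t₀ * eMinusZ r t₀)

/-- `E₁(t,t₀,ξ)` in the case `μ = 1/4`, `ν = 0`. -/
def E1Z (r t t₀ : ℝ) : ℂ :=
  (ePlus 0 r t₀ * eMinusZ r t - ePlus 0 r t * eMinusZ r t₀) /
    (ePlus 0 r t₀ * eMinusZDot r t₀ - ePlusDot 0 r t₀ * eMinusZ r t₀)

/-- `Ė₀` in the case `μ = 1/4`. -/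
def E0Zdot (r t t₀ : ℝ) : ℂ := deriv (fun s => E0Z r s t₀) t

/-- `Ė₁` in the case `μ = 1/4`. -/
def E1Zdot (r t t₀ : ℝ) : ℂ := deriv (fun s => E1Z r s t₀) t



/-- Coefficients of the entire function `f` with `J_ν(τ) = (τ/2)^ν f((τ/2)²)`. -/
def besselCoeff (ν : ℂ) (k : ℕ) : ℂ :=
  (-1 : ℂ) ^ k / ((Nat.factorial k : ℂ) * Complex.Gamma (ν + k + 1))

theorem besselCoeff_succ {ν : ℂ} (hν : ∀ k : ℕ, ν + k + 1 ≠ 0) (k : ℕ) :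
    ((k : ℂ) + 1) * (ν + k + 1) * besselCoeff ν (k + 1) = -besselCoeff ν k := by
  have h1 : Complex.Gamma (ν + (k + 1 : ℕ) + 1) = (ν + k + 1) * Complex.Gamma (ν + k + 1) := by
    rw [← Complex.Gamma_add_one _ (hν k)]
    push_cast
    ring_nf
  have h2 : Complex.Gamma (ν + k + 1) ≠ 0 := by
    refine Complex.Gamma_ne_zero fun m hm => hν (k + m) ?_
    push_cast
    linear_combination hm
  have h3 : (Nat.factorial k : ℂ) ≠ 0 := by exact_mod_cast Nat.factorial_ne_zero k
  have h4 : (k : ℂ) + 1 ≠ 0 := by exact_mod_cast Nat.succ_ne_zero k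
  have h5 := hν k
  rw [besselCoeff, besselCoeff, h1, Nat.factorial_succ]
  push_cast
  field_simp
  ring

theorem summable_besselCoeff {n : ℝ} (hn : ∀ k : ℕ, (n : ℂ) + k + 1 ≠ 0) (R : ℝ) :
    Summable fun k => ‖besselCoeff n k‖ * R ^ k := by
  refine summable_of_ratio_norm_eventually_le (r := 1 / 2) (by norm_num) ?_
  filter_upwards [Filter.eventually_ge_atTop ⌈max (-n) (2 * |R|)⌉₊] with k hk
  have hk' : max (-n) (2 * |R|) ≤ k := Nat.ceil_le.mp hk
  have hk1 : -n ≤ k := (le_max_left _ _).trans hk'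
  have hk2 : 2 * |R| ≤ k := (le_max_right _ _).trans hk'
  have h := congrArg norm (besselCoeff_succ hn k)
  rw [norm_mul, norm_mul, norm_neg] at h
  have e1 : ‖(k : ℂ) + 1‖ = k + 1 := by
    rw [show (k : ℂ) + 1 = ((k + 1 : ℝ) : ℂ) by push_cast; ring, Complex.norm_real,
      Real.norm_of_nonneg (by positivity)]
  have e2 : ‖(n : ℂ) + k + 1‖ = n + k + 1 := by
    rw [show (n : ℂ) + k + 1 = ((n + k + 1 : ℝ) : ℂ) by push_cast; ring, Complex.norm_real,
      Real.norm_of_nonneg (by linarith)]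
  rw [e1, e2] at h
  rw [norm_mul, norm_mul, norm_norm, norm_norm, norm_pow, norm_pow, Real.norm_eq_abs, pow_succ, ← h]
  have hB := norm_nonneg (besselCoeff n (k + 1))
  have hP : 0 ≤ |R| ^ k := by positivity
  have h6 : 2 * |R| ≤ ((k : ℝ) + 1) * (n + k + 1) := by nlinarith [abs_nonneg R]
  nlinarith [mul_nonneg hB hP, mul_le_mul_of_nonneg_left h6 (mul_nonneg hB hP)]

theorem summable_succ_mul_norm {c : ℕ → ℂ} (hc : ∀ R : ℝ, Summable fun k => ‖c k‖ * R ^ k)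
    (R : ℝ) : Summable fun k : ℕ => ‖((k : ℂ) + 1) * c (k + 1)‖ * R ^ k := by
  have h := (summable_nat_add_iff 1).mpr (hc (2 * (|R| + 1)))
  refine Summable.of_norm_bounded h fun k => ?_
  rw [norm_mul, norm_norm, norm_mul, norm_pow, Real.norm_eq_abs]
  have e1 : ‖(k : ℂ) + 1‖ = k + 1 := by
    rw [show (k : ℂ) + 1 = ((k + 1 : ℝ) : ℂ) by push_cast; ring, Complex.norm_real,
      Real.norm_of_nonneg (by positivity)]
  rw [e1, mul_pow]
  have h2 : (k : ℝ) + 1 ≤ (2 : ℝ) ^ (k + 1 : ℕ) := by exact_mod_cast (Nat.lt_two_pow_self : k + 1 < 2 ^ (k + 1)).le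
  have h3 : |R| ^ k ≤ (|R| + 1) ^ (k + 1) := by
    calc |R| ^ k ≤ (|R| + 1) ^ k := by gcongr; linarith
      _ ≤ (|R| + 1) ^ (k + 1) := by
        apply pow_le_pow_right₀ (by linarith [abs_nonneg R]) (by omega)
  calc ((k : ℝ) + 1) * ‖c (k + 1)‖ * |R| ^ k
      = ‖c (k + 1)‖ * (((k : ℝ) + 1) * |R| ^ k) := by ring
    _ ≤ _ := by gcongr

theorem summable_mul_pow {c : ℕ → ℂ} (hc : ∀ R : ℝ, Summable fun k => ‖c k‖ * R ^ k) (z : ℂ) :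
    Summable fun k => c k * z ^ k :=
  Summable.of_norm_bounded (hc ‖z‖) fun k => by rw [norm_mul, norm_pow]

theorem hasDerivAt_tsum_mul_pow {c : ℕ → ℂ} (hc : ∀ R : ℝ, Summable fun k => ‖c k‖ * R ^ k)
    (z : ℂ) :
    HasDerivAt (fun z => ∑' k, c k * z ^ k) (∑' k : ℕ, ((k : ℂ) + 1) * c (k + 1) * z ^ k) z := by
  have hu : Summable fun k : ℕ => ‖(k : ℂ) * c k‖ * (‖z‖ + 1) ^ (k - 1) := by
    refine (summable_nat_add_iff 1).mp ?_
    simpa using summable_succ_mul_norm hc (‖z‖ + 1)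
  have h := hasDerivAt_tsum_of_isPreconnected (g := fun k z => c k * z ^ k)
    (g' := fun k z => c k * (k * z ^ (k - 1))) (y₀ := z) (y := z) hu
    (Metric.isOpen_ball (x := (0 : ℂ)) (ε := ‖z‖ + 1))
    (convex_ball (0 : ℂ) (‖z‖ + 1)).isPreconnected
    (fun k w _ => (hasDerivAt_pow k w).const_mul (c k))
    (fun k w hw => by
      rw [← mul_assoc, mul_comm (c k), norm_mul, norm_pow]
      have : ‖w‖ ≤ ‖z‖ + 1 := by simpa using (mem_ball_zero_iff.mp hw).le
      gcongr)
    (by simp) (summable_mul_pow hc z) (by simp)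
  refine h.congr_deriv ?_
  have hs : Summable fun k : ℕ => c k * (k * z ^ (k - 1)) := by
    refine (summable_nat_add_iff 1).mp ?_
    refine (summable_mul_pow (summable_succ_mul_norm hc) z).congr fun k => ?_
    push_cast
    ring
  rw [hs.tsum_eq_zero_add]
  simp only [Nat.cast_zero, zero_mul, mul_zero, zero_add]
  refine tsum_congr fun k => ?_
  push_cast
  ring

/-- The differential equation `z f'' + (ν + 1) f' + f = 0` satisfied by the entire part of `J_ν`. -/
theorem besselCoeff_ode {n : ℝ} (hn : ∀ k : ℕ, (n : ℂ) + k + 1 ≠ 0) (z : ℂ) :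
    z * (∑' k : ℕ, ((k : ℂ) + 1) * (((k + 1 : ℕ) : ℂ) + 1) * besselCoeff n (k + 1 + 1) * z ^ k) +
      (n + 1) * (∑' k : ℕ, ((k : ℂ) + 1) * besselCoeff n (k + 1) * z ^ k) +
      ∑' k : ℕ, besselCoeff n k * z ^ k = 0 := by
  have h0 := summable_besselCoeff hn
  have h1 := summable_succ_mul_norm h0
  have h2 := summable_succ_mul_norm h1
  have s2 : Summable fun k : ℕ => (k : ℂ) * (((k : ℂ) + 1) * besselCoeff n (k + 1)) * z ^ k := by
    refine (summable_nat_add_iff 1).mp ?_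
    refine ((summable_mul_pow h2 z).mul_left z).congr fun k => ?_
    push_cast
    ring
  have e2 : z * (∑' k : ℕ, ((k : ℂ) + 1) * (((k + 1 : ℕ) : ℂ) + 1) * besselCoeff n (k + 1 + 1)
      * z ^ k) = ∑' k : ℕ, (k : ℂ) * (((k : ℂ) + 1) * besselCoeff n (k + 1)) * z ^ k := by
    rw [s2.tsum_eq_zero_add, ← tsum_mul_left]
    simp only [Nat.cast_zero, zero_mul, zero_add]
    refine tsum_congr fun k => ?_
    push_cast
    ring
  rw [e2, ← tsum_mul_left, ← s2.tsum_add ((summable_mul_pow h1 z).mul_left _),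
    ← (s2.add ((summable_mul_pow h1 z).mul_left _)).tsum_add (summable_mul_pow h0 z)]
  rw [← tsum_zero (α := ℂ) (β := ℕ)]
  refine tsum_congr fun k => ?_
  linear_combination z ^ k * besselCoeff_succ hn k

/-- `y` solves `y'' + (r² - m / (1 + t)²) y = 0` on `t > -1`, where `y'` is the derivative of `y`. -/
def IsKGSolution (m r : ℝ) (y y' : ℝ → ℂ) : Prop :=
  ∀ t : ℝ, -1 < t → HasDerivAt y (y' t) t ∧
    HasDerivAt y' (((m / (1 + t) ^ 2 - r ^ 2 : ℝ) : ℂ) * y t) t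

theorem IsKGSolution.linComb {m r : ℝ} {y y' z z' : ℝ → ℂ} (hy : IsKGSolution m r y y')
    (hz : IsKGSolution m r z z') (α β : ℂ) :
    IsKGSolution m r (fun t => α * y t + β * z t) (fun t => α * y' t + β * z' t) := by
  intro t ht
  refine ⟨((hy t ht).1.const_mul α).add ((hz t ht).1.const_mul β), ?_⟩
  refine (((hy t ht).2.const_mul α).add ((hz t ht).2.const_mul β)).congr_deriv ?_
  ring

theorem IsKGSolution.congr {m r : ℝ} {y y' z : ℝ → ℂ} (hy : IsKGSolution m r y y')
    (h : ∀ t, -1 < t → z t = y t) : IsKGSolution m r z y' := by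
  intro t ht
  have hev : z =ᶠ[nhds t] y := by
    filter_upwards [lt_mem_nhds ht] with s hs using h s hs
  refine ⟨(hy t ht).1.congr_of_eventuallyEq hev, ?_⟩
  rw [h t ht]
  exact (hy t ht).2

theorem sqrt_mul_besselJ_eq (n : ℝ) {r s : ℝ} (hr : 0 < r) (hs : 0 < s) :
    (Real.sqrt (s * r) : ℂ) * besselJ n (s * r) =
      ((r ^ (1 / 2 + n) / 2 ^ n : ℝ) : ℂ) * ((s ^ (1 / 2 + n) : ℝ) : ℂ) *
        ∑' k, besselCoeff n k * (((s * r / 2) ^ 2 : ℝ) : ℂ) ^ k := by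
  have hpos : 0 < s * r / 2 := by positivity
  have hJ : besselJ n (s * r) = (((s * r / 2) ^ n : ℝ) : ℂ) *
      ∑' k, besselCoeff n k * (((s * r / 2) ^ 2 : ℝ) : ℂ) ^ k := by
    rw [besselJ, ← tsum_mul_left]
    refine tsum_congr fun k => ?_
    have : (((s * r : ℝ) : ℂ) / 2) ^ ((n : ℂ) + 2 * (k : ℂ)) =
        (((s * r / 2) ^ n : ℝ) : ℂ) * (((s * r / 2) ^ 2 : ℝ) : ℂ) ^ k := by
      rw [← Complex.ofReal_pow, ← pow_mul, ← Complex.ofReal_mul, ← Real.rpow_natCast,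
        ← Real.rpow_add hpos, Complex.ofReal_cpow hpos.le]
      push_cast
      rfl
    rw [this, besselCoeff]
    ring
  rw [hJ, ← mul_assoc, ← Complex.ofReal_mul, ← Complex.ofReal_mul]
  congr 2
  rw [Real.sqrt_eq_rpow, Real.mul_rpow hs.le hr.le, Real.div_rpow (by positivity) (by norm_num),
    Real.mul_rpow hs.le hr.le, Real.rpow_add hs, Real.rpow_add hr]
  ring

theorem exists_isKGSolution_sqrt_mul_besselJ {n : ℝ} (hn : ∀ k : ℕ, (n : ℂ) + k + 1 ≠ 0) {r : ℝ}
    (hr : 0 < r) :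
    ∃ y', IsKGSolution (n ^ 2 - 1 / 4) r
      (fun t => (Real.sqrt ((1 + t) * r) : ℂ) * besselJ n ((1 + t) * r)) y' := by
  have h0 := summable_besselCoeff hn
  have h1 := summable_succ_mul_norm h0
  set f : ℂ → ℂ := fun z => ∑' k, besselCoeff n k * z ^ k with hf
  set f1 : ℂ → ℂ := fun z => ∑' k : ℕ, ((k : ℂ) + 1) * besselCoeff n (k + 1) * z ^ k with hf1
  set f2 : ℂ → ℂ := fun z => ∑' k : ℕ, ((k : ℂ) + 1) *
    ((((k + 1 : ℕ) : ℂ) + 1) * besselCoeff n (k + 1 + 1)) * z ^ k with hf2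
  have hd : ∀ z, HasDerivAt f (f1 z) z := hasDerivAt_tsum_mul_pow h0
  have hd1 : ∀ z, HasDerivAt f1 (f2 z) z := hasDerivAt_tsum_mul_pow h1
  have hode : ∀ z, z * f2 z + (n + 1) * f1 z + f z = 0 := fun z => by
    have := besselCoeff_ode hn z
    simpa only [hf2, hf1, hf, mul_assoc] using this
  clear_value f f1 f2
  set A : ℂ := ((r ^ (1 / 2 + n) / 2 ^ n : ℝ) : ℂ) with hA
  set a : ℝ := 1 / 2 + n with ha
  set Z : ℝ → ℂ := fun t => ((((1 + t) * r / 2) ^ 2 : ℝ) : ℂ) with hZdef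
  have hZ : ∀ t, HasDerivAt Z (((1 + t) * r ^ 2 / 2 : ℝ) : ℂ) t := fun t => by
    refine HasDerivAt.ofReal_comp ?_
    have := (((((hasDerivAt_id t).const_add 1).mul_const r).div_const 2).pow 2)
    refine this.congr_deriv ?_
    simp
    ring
  have hP : ∀ p t : ℝ, -1 < t →
      HasDerivAt (fun t : ℝ => (((1 + t) ^ p : ℝ) : ℂ)) ((p * (1 + t) ^ (p - 1) : ℝ) : ℂ) t := by
    intro p t ht
    refine HasDerivAt.ofReal_comp ?_
    have := ((hasDerivAt_id t).const_add 1).rpow_const (p := p) (Or.inl (by simp; linarith))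
    refine this.congr_deriv ?_
    simp
  refine ⟨fun t => A * ((a : ℂ) * (((1 + t) ^ (a - 1) : ℝ) : ℂ) * f (Z t) +
    (((1 + t) ^ a : ℝ) : ℂ) * (f1 (Z t) * (((1 + t) * r ^ 2 / 2 : ℝ) : ℂ))), ?_⟩
  refine IsKGSolution.congr (y := fun t => A * ((((1 + t) ^ a : ℝ) : ℂ) * f (Z t))) ?_ ?_
  · intro t ht
    have hs : 0 < 1 + t := by linarith
    have hfZ : HasDerivAt (fun t => f (Z t)) (f1 (Z t) * (((1 + t) * r ^ 2 / 2 : ℝ) : ℂ)) t :=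
      (hd (Z t)).comp t (hZ t)
    have hf1Z : HasDerivAt (fun t => f1 (Z t)) (f2 (Z t) * (((1 + t) * r ^ 2 / 2 : ℝ) : ℂ)) t :=
      (hd1 (Z t)).comp t (hZ t)
    have hL : HasDerivAt (fun t : ℝ => (((1 + t) * r ^ 2 / 2 : ℝ) : ℂ)) ((r ^ 2 / 2 : ℝ) : ℂ) t := by
      refine HasDerivAt.ofReal_comp ?_
      have := ((((hasDerivAt_id t).const_add 1).mul_const (r ^ 2)).div_const 2)
      refine this.congr_deriv ?_
      simp
    constructor
    · refine (((hP a t ht).mul hfZ).const_mul A).congr_deriv ?_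
      push_cast
      ring
    · refine (((((hP (a - 1) t ht).const_mul (a : ℂ)).mul hfZ).add
        ((hP a t ht).mul (hf1Z.mul hL))).const_mul A).congr_deriv ?_
      have e1 : (1 + t) ^ (a - 1) = (1 + t) ^ (a - 1 - 1) * (1 + t) := by
        rw [← Real.rpow_add_one hs.ne']; ring_nf
      have e2 : (1 + t) ^ a = (1 + t) ^ (a - 1 - 1) * (1 + t) ^ 2 := by
        rw [pow_two, ← mul_assoc, ← e1, ← Real.rpow_add_one hs.ne']; ring_nf
      dsimp only [Pi.mul_apply]
      rw [e2, e1]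
      have hs' : (1 : ℂ) + t ≠ 0 := by exact_mod_cast hs.ne'
      have h := hode (Z t)
      have hz : Z t = ((1 + t) * r / 2) ^ 2 := by simp [hZdef]
      have ha' : (n : ℂ) = a - 1 / 2 := by rw [ha]; push_cast; ring
      have hn' : n = a - 1 / 2 := by rw [ha]; ring
      rw [ha'] at h
      rw [hn']
      generalize f (Z t) = F at *
      generalize f1 (Z t) = F1 at *
      generalize f2 (Z t) = F2 at *
      generalize (1 + t) ^ (a - 1 - 1) = P at *
      rw [hz] at h
      push_cast
      field_simp
      linear_combination (16 : ℂ) * A * P * (1 + t) ^ 2 * r ^ 2 * h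
  · intro t ht
    have hs : 0 < 1 + t := by linarith
    rw [sqrt_mul_besselJ_eq n hr hs, mul_assoc]
    simp only [hf, hZdef]
    rfl

section Energy

variable {a r t₀ t : ℝ} {w v : ℝ → ℝ}

theorem antitoneOn_of_hasDerivAt_nonpos {f f' : ℝ → ℝ} {t₀ : ℝ}
    (hf : ∀ t, t₀ ≤ t → HasDerivAt f (f' t) t) (hf' : ∀ t, t₀ ≤ t → f' t ≤ 0) :
    AntitoneOn f (Ici t₀) := by
  refine antitoneOn_of_hasDerivWithinAt_nonpos (f' := f') (convex_Ici t₀)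
    (fun t ht => (hf t ht).continuousAt.continuousWithinAt) ?_ ?_
  · intro t ht
    rw [interior_Ici] at ht
    exact (hf t (le_of_lt ht)).hasDerivWithinAt
  · intro t ht
    rw [interior_Ici] at ht
    exact hf' t (le_of_lt ht)

/-- Monotonicity of `w'² + r² w²` for solutions of `w'' + (2a/(1+t)) w' + r² w = 0`. -/
theorem damped_energy_le (ha : 0 ≤ a) (ht₀ : 0 ≤ t₀)
    (hw : ∀ t, t₀ ≤ t → HasDerivAt w (v t) t)
    (hv : ∀ t, t₀ ≤ t → HasDerivAt v (-(2 * a / (1 + t)) * v t - r ^ 2 * w t) t) (ht : t₀ ≤ t) :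
    v t ^ 2 + r ^ 2 * w t ^ 2 ≤ v t₀ ^ 2 + r ^ 2 * w t₀ ^ 2 := by
  refine antitoneOn_of_hasDerivAt_nonpos (f := fun t => v t ^ 2 + r ^ 2 * w t ^ 2)
    (f' := fun t => -(4 * a / (1 + t) * v t ^ 2)) (fun s hs => ?_) (fun s hs => ?_)
    (mem_Ici.mpr le_rfl) (mem_Ici.mpr ht) ht
  · refine (((hv s hs).pow 2).add (((hw s hs).pow 2).const_mul (r ^ 2))).congr_deriv ?_
    simp
    ring
  · have : 0 < 1 + s := by linarith
    have : 0 ≤ 4 * a / (1 + s) * v s ^ 2 := by positivity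
    linarith

/-- Monotonicity of `((2a-1) w + (1+t) w')² + r² (1+t)² w²` for solutions of
`w'' + (2a/(1+t)) w' + r² w = 0`. -/
theorem damped_weighted_energy_le (ha : 1 ≤ a) (ht₀ : 0 ≤ t₀)
    (hw : ∀ t, t₀ ≤ t → HasDerivAt w (v t) t)
    (hv : ∀ t, t₀ ≤ t → HasDerivAt v (-(2 * a / (1 + t)) * v t - r ^ 2 * w t) t) (ht : t₀ ≤ t) :
    ((2 * a - 1) * w t + (1 + t) * v t) ^ 2 + (r * (1 + t) * w t) ^ 2 ≤
      ((2 * a - 1) * w t₀ + (1 + t₀) * v t₀) ^ 2 + (r * (1 + t₀) * w t₀) ^ 2 := by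
  refine antitoneOn_of_hasDerivAt_nonpos
    (f := fun t => ((2 * a - 1) * w t + (1 + t) * v t) ^ 2 + (r * (1 + t) * w t) ^ 2)
    (f' := fun t => -(4 * (a - 1) * r ^ 2 * (1 + t) * w t ^ 2))
    (fun s hs => ?_) (fun s hs => ?_) (mem_Ici.mpr le_rfl) (mem_Ici.mpr ht) ht
  · have hs' : 1 + s ≠ 0 := by linarith
    have h1 : HasDerivAt (fun t : ℝ => 1 + t) 1 s := (hasDerivAt_id s).const_add 1
    refine (((((hw s hs).const_mul (2 * a - 1)).add (h1.mul (hv s hs))).pow 2).add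
      (((h1.const_mul r).mul (hw s hs)).pow 2)).congr_deriv ?_
    simp
    field_simp
    ring
  · have h1 : 0 < 1 + s := by linarith
    have h2 : 0 ≤ a - 1 := by linarith
    have : 0 ≤ 4 * (a - 1) * r ^ 2 * (1 + s) * w s ^ 2 := by positivity
    linarith

theorem le_of_weighted_deriv_le {k : ℝ} (ht₀ : 0 ≤ t₀)
    (hw : ∀ t, t₀ ≤ t → HasDerivAt w (v t) t) (h0 : w t₀ ≤ k)
    (hk : ∀ t, t₀ ≤ t → (2 * a - 1) * w t + (1 + t) * v t ≤ (2 * a - 1) * k) (ht : t₀ ≤ t) :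
    w t ≤ k := by
  have h := antitoneOn_of_hasDerivAt_nonpos (t₀ := t₀)
    (f := fun t => (1 + t) ^ (2 * a - 1) * (w t - k))
    (f' := fun t => (1 + t) ^ (2 * a - 1 - 1) *
      ((2 * a - 1) * w t + (1 + t) * v t - (2 * a - 1) * k)) (fun s hs => ?_) (fun s hs => ?_)
    (mem_Ici.mpr le_rfl) (mem_Ici.mpr ht) ht
  · have h1 : 0 < (1 + t) ^ (2 * a - 1) := Real.rpow_pos_of_pos (by linarith) _
    have h2 : 0 < (1 + t₀) ^ (2 * a - 1) := Real.rpow_pos_of_pos (by linarith) _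
    simp only at h
    by_contra! hcon
    nlinarith [mul_pos h1 (sub_pos.mpr hcon)]
  · have hs' : 0 < 1 + s := by linarith
    have h1 := ((hasDerivAt_id s).const_add 1).rpow_const (p := 2 * a - 1)
      (Or.inl (by simpa using hs'.ne'))
    refine (h1.mul ((hw s hs).sub_const k)).congr_deriv ?_
    have e1 : (1 + s) ^ (2 * a - 1) = (1 + s) ^ (2 * a - 1 - 1) * (1 + s) := by
      rw [← Real.rpow_add_one hs'.ne']; ring_nf
    simp only [id, e1]
    ring
  · have h1 : 0 < (1 + s) ^ (2 * a - 1 - 1) := Real.rpow_pos_of_pos (by linarith) _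
    have := hk s hs
    exact mul_nonpos_of_nonneg_of_nonpos h1.le (by linarith)

/-- Pointwise bounds for real solutions of `y'' + (r² - a(a-1)/(1+t)²) y = 0`. -/
theorem kg_real_bounds {y y' : ℝ → ℝ} (ha : 1 < a) (hr : 0 < r) (ht₀ : 0 ≤ t₀)
    (hy : ∀ t, t₀ ≤ t → HasDerivAt y (y' t) t)
    (hy' : ∀ t, t₀ ≤ t → HasDerivAt y' ((a * (a - 1) / (1 + t) ^ 2 - r ^ 2) * y t) t)
    (ht : t₀ ≤ t) :
    |y t| ≤ (1 + t) ^ a * (1 + t₀) ^ (-a) * ((4 + a) * (|y t₀| + (1 + t₀) * |y' t₀|)) ∧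
    r * |y t| ≤ (1 + t) ^ (a - 1) * (1 + t₀) ^ (-a) *
      ((2 * a - 1) * (|y t₀| + (1 + t₀) * |y' t₀| + r * (1 + t₀) * |y t₀|)) ∧
    |y' t| ≤ (1 + t) ^ (a - 1) * (1 + t₀) ^ (-a) *
      (2 * (2 * a - 1) * (|y t₀| + (1 + t₀) * |y' t₀| + r * (1 + t₀) * |y t₀|)) := by
  set w : ℝ → ℝ := fun t => (1 + t) ^ (-a) * y t with hwdef
  set v : ℝ → ℝ := fun t => (1 + t) ^ (-a) * (y' t - a / (1 + t) * y t) with hvdef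
  have hs : ∀ {s : ℝ}, t₀ ≤ s → 0 < 1 + s := fun h => by linarith
  have hP : ∀ s, t₀ ≤ s →
      HasDerivAt (fun t : ℝ => (1 + t) ^ (-a)) (-a / (1 + s) * (1 + s) ^ (-a)) s := fun s h => by
    have h1 := ((hasDerivAt_id s).const_add 1).rpow_const (p := -a)
      (Or.inl (by simpa using (hs h).ne'))
    refine h1.congr_deriv ?_
    simp only [id, Real.rpow_sub_one (hs h).ne']
    ring
  have hw : ∀ t, t₀ ≤ t → HasDerivAt w (v t) t := fun s h => by
    refine ((hP s h).mul (hy s h)).congr_deriv ?_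
    simp only [hvdef]
    ring
  have hv : ∀ t, t₀ ≤ t → HasDerivAt v (-(2 * a / (1 + t)) * v t - r ^ 2 * w t) t := fun s h => by
    have h1 : HasDerivAt (fun t : ℝ => a / (1 + t)) (-a / (1 + s) ^ 2) s := by
      have := (hasDerivAt_const s a).div ((hasDerivAt_id s).const_add 1) (hs h).ne'
      refine this.congr_deriv ?_
      simp
    refine ((hP s h).mul ((hy' s h).sub (h1.mul (hy s h)))).congr_deriv ?_
    have := (hs h).ne'
    simp only [hvdef, hwdef, Pi.sub_apply, Pi.mul_apply]
    field_simp
    ring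
  have hs0 := hs le_rfl
  have hst := hs ht
  set Q := (1 + t₀) ^ (-a) with hQ
  have hQpos : 0 < Q := Real.rpow_pos_of_pos hs0 _
  set D := |y t₀| + (1 + t₀) * |y' t₀| + r * (1 + t₀) * |y t₀| with hD
  have hb : 0 < 2 * a - 1 := by linarith
  have hD0 : 0 ≤ D := by positivity
  have hw0 : w t₀ = Q * y t₀ := rfl
  have hw0' : |w t₀| = Q * |y t₀| := by rw [hw0, abs_mul, abs_of_pos hQpos]
  have hu0 : (2 * a - 1) * w t₀ + (1 + t₀) * v t₀ = Q * ((a - 1) * y t₀ + (1 + t₀) * y' t₀) := by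
    simp only [hw0, hvdef]
    field_simp
    ring
  have hk0 : ((2 * a - 1) * w t₀ + (1 + t₀) * v t₀) ^ 2 + (r * (1 + t₀) * w t₀) ^ 2 ≤
      ((2 * a - 1) * (Q * D)) ^ 2 := by
    rw [hu0, hw0]
    have h1 : |(a - 1) * y t₀ + (1 + t₀) * y' t₀| ≤
        (2 * a - 1) * (|y t₀| + (1 + t₀) * |y' t₀|) := by
      refine (abs_add_le _ _).trans ?_
      rw [abs_mul, abs_mul, abs_of_pos hs0, abs_of_pos (by linarith : 0 < a - 1)]
      have e1 : 0 ≤ a * |y t₀| := by positivity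
      have e2 : 0 ≤ (a - 1) * ((1 + t₀) * |y' t₀|) :=
        mul_nonneg (by linarith) (by positivity)
      linarith
    have h2 : |r * (1 + t₀) * y t₀| ≤ (2 * a - 1) * (r * (1 + t₀) * |y t₀|) := by
      rw [abs_mul, abs_of_pos (by positivity : 0 < r * (1 + t₀))]
      exact le_mul_of_one_le_left (by positivity) (by linarith)
    have h3 := abs_nonneg ((a - 1) * y t₀ + (1 + t₀) * y' t₀)
    have h4 := abs_nonneg (r * (1 + t₀) * y t₀)
    have h5 : |(a - 1) * y t₀ + (1 + t₀) * y' t₀| + |r * (1 + t₀) * y t₀| ≤ (2 * a - 1) * D := by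
      rw [hD, mul_add (2 * a - 1)]
      exact add_le_add h1 h2
    calc (Q * ((a - 1) * y t₀ + (1 + t₀) * y' t₀)) ^ 2 + (r * (1 + t₀) * (Q * y t₀)) ^ 2
        = Q ^ 2 * (|(a - 1) * y t₀ + (1 + t₀) * y' t₀| ^ 2 + |r * (1 + t₀) * y t₀| ^ 2) := by
          rw [sq_abs, sq_abs]; ring
      _ ≤ Q ^ 2 * (|(a - 1) * y t₀ + (1 + t₀) * y' t₀| + |r * (1 + t₀) * y t₀|) ^ 2 := by
          gcongr
          linarith [mul_nonneg h3 h4, add_sq |(a - 1) * y t₀ + (1 + t₀) * y' t₀| |r * (1 + t₀) * y t₀|]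
      _ ≤ Q ^ 2 * ((2 * a - 1) * D) ^ 2 := by gcongr
      _ = _ := by ring
  have hk : ∀ s, t₀ ≤ s → |(2 * a - 1) * w s + (1 + s) * v s| ≤ (2 * a - 1) * (Q * D) ∧
      |r * (1 + s) * w s| ≤ (2 * a - 1) * (Q * D) := fun s h => by
    have h1 := (damped_weighted_energy_le ha.le ht₀ hw hv h).trans hk0
    have h2 : 0 ≤ (2 * a - 1) * (Q * D) := by positivity
    constructor
    · exact abs_le_of_sq_le_sq (by linarith [sq_nonneg (r * (1 + s) * w s)]) h2
    · exact abs_le_of_sq_le_sq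
        (by linarith [sq_nonneg ((2 * a - 1) * w s + (1 + s) * v s)]) h2
  have hw0D : |w t₀| ≤ Q * D := by
    rw [hw0']
    gcongr
    rw [hD]
    have : 0 ≤ (1 + t₀) * |y' t₀| := by positivity
    have : 0 ≤ r * (1 + t₀) * |y t₀| := by positivity
    linarith
  have hwD : |w t| ≤ Q * D := by
    rw [abs_le']
    constructor
    · exact le_of_weighted_deriv_le (a := a) ht₀ hw ((le_abs_self _).trans hw0D)
        (fun s h => (le_abs_self _).trans (hk s h).1) ht
    · refine le_of_weighted_deriv_le (w := fun t => -w t) (v := fun t => -v t) (a := a) ht₀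
        (fun s h => (hw s h).neg) ((neg_le_abs _).trans hw0D)
        (fun s h => le_trans (le_of_eq ?_) ((neg_le_abs _).trans (hk s h).1)) ht
      ring
  have hPpos : 0 < (1 + t) ^ a := Real.rpow_pos_of_pos hst _
  have hP1pos : 0 < (1 + t) ^ (a - 1) := Real.rpow_pos_of_pos hst _
  have eP : (1 + t) ^ a = (1 + t) ^ (a - 1) * (1 + t) := by
    rw [← Real.rpow_add_one hst.ne']; ring_nf
  have ey : y t = (1 + t) ^ a * w t := by
    simp only [hwdef]
    rw [← mul_assoc, ← Real.rpow_add hst]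
    simp
  have ey' : y' t = (1 + t) ^ (a - 1) * (a * w t + (1 + t) * v t) := by
    have e : (1 + t) ^ (a - 1) * ((1 + t) * (1 + t) ^ (-a)) = 1 := by
      rw [← mul_assoc, ← eP, ← Real.rpow_add hst]
      simp
    have e2 : a * w t + (1 + t) * v t = (1 + t) * (1 + t) ^ (-a) * y' t := by
      simp only [hwdef, hvdef]
      field_simp
      ring
    rw [e2, ← mul_assoc, e, one_mul]
  refine ⟨?_, ?_, ?_⟩
  · rw [ey, abs_mul, abs_of_pos hPpos, mul_assoc]
    refine mul_le_mul_of_nonneg_left ?_ hPpos.le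
    have hy0 := abs_nonneg (y t₀)
    have hy1 : 0 ≤ (1 + t₀) * |y' t₀| := by positivity
    rcases le_total (r * (1 + t₀)) 1 with h | h
    · refine hwD.trans (mul_le_mul_of_nonneg_left ?_ hQpos.le)
      have e1 : r * (1 + t₀) * |y t₀| ≤ 1 * |y t₀| := by gcongr
      have e2 : 0 ≤ (2 + a) * |y t₀| := by positivity
      have e3 : 0 ≤ (3 + a) * ((1 + t₀) * |y' t₀|) := by positivity
      linarith
    · have hG := damped_energy_le (by linarith) ht₀ hw hv ht
      have h1 : (r * w t) ^ 2 ≤ (|v t₀| + r * |w t₀|) ^ 2 := by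
        have e : (|v t₀| + r * |w t₀|) ^ 2 =
            v t₀ ^ 2 + r ^ 2 * w t₀ ^ 2 + 2 * (|v t₀| * (r * |w t₀|)) := by
          rw [← sq_abs (v t₀), ← sq_abs (w t₀)]; ring
        have : 0 ≤ |v t₀| * (r * |w t₀|) := by positivity
        rw [e, mul_pow]
        linarith [sq_nonneg (v t)]
      have h2 := abs_le_of_sq_le_sq h1 (by positivity)
      rw [abs_mul, abs_of_pos hr] at h2
      have h3 : (1 + t₀) * |v t₀| ≤ Q * ((1 + t₀) * |y' t₀| + a * |y t₀|) := by
        have e : (1 + t₀) * v t₀ = Q * ((1 + t₀) * y' t₀ - a * y t₀) := by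
          simp only [hvdef, hQ]
          field_simp
        rw [← abs_of_pos hs0, ← abs_mul, e, abs_mul, abs_of_pos hQpos, abs_of_pos hs0]
        gcongr
        refine (abs_sub _ _).trans ?_
        rw [abs_mul, abs_mul, abs_of_pos hs0, abs_of_pos (by linarith : 0 < a)]
      have h4 : |v t₀| ≤ r * ((1 + t₀) * |v t₀|) := by
        rw [← mul_assoc]
        exact le_mul_of_one_le_left (abs_nonneg _) h
      have h5 : r * |w t| ≤
          r * (Q * ((1 + t₀) * |y' t₀| + a * |y t₀|) + Q * |y t₀|) := by
        rw [mul_add]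
        refine h2.trans (add_le_add (h4.trans ?_) (mul_le_mul_of_nonneg_left hw0'.le hr.le))
        gcongr
      refine (le_of_mul_le_mul_left h5 hr).trans ?_
      rw [← mul_add]
      refine mul_le_mul_of_nonneg_left ?_ hQpos.le
      have e3 : 0 ≤ (3 + a) * ((1 + t₀) * |y' t₀|) := by positivity
      linarith
  · have h := (hk t ht).2
    rw [ey, abs_mul, abs_of_pos hPpos, eP]
    rw [abs_mul, abs_of_pos (by positivity : 0 < r * (1 + t))] at h
    calc r * ((1 + t) ^ (a - 1) * (1 + t) * |w t|)
        = (1 + t) ^ (a - 1) * (r * (1 + t) * |w t|) := by ring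
      _ ≤ (1 + t) ^ (a - 1) * ((2 * a - 1) * (Q * D)) := by gcongr
      _ = _ := by ring
  · have h := (hk t ht).1
    rw [ey', abs_mul, abs_of_pos hP1pos, mul_assoc]
    refine mul_le_mul_of_nonneg_left ?_ hP1pos.le
    have e : a * w t + (1 + t) * v t =
        ((2 * a - 1) * w t + (1 + t) * v t) - (a - 1) * w t := by ring
    rw [e]
    refine (abs_sub _ _).trans ?_
    rw [abs_mul (a - 1), abs_of_pos (by linarith : 0 < a - 1)]
    have e1 : 0 ≤ a * (Q * D) := by positivity
    have e2 : (a - 1) * |w t| ≤ (a - 1) * (Q * D) :=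
      mul_le_mul_of_nonneg_left hwD (by linarith)
    linarith

end Energy

/-- Pointwise bounds for complex solutions with real Cauchy data. -/
theorem IsKGSolution.bounds {a r t₀ t α β : ℝ} {y y' : ℝ → ℂ}
    (h : IsKGSolution (a * (a - 1)) r y y') (ha : 1 < a) (hr : 0 < r) (ht₀ : 0 ≤ t₀)
    (ht : t₀ ≤ t) (hα : y t₀ = α) (hβ : y' t₀ = β) :
    ‖y t‖ ≤ (1 + t) ^ a * (1 + t₀) ^ (-a) * ((4 + a) * (|α| + (1 + t₀) * |β|)) ∧
    r * ‖y t‖ ≤ (1 + t) ^ (a - 1) * (1 + t₀) ^ (-a) *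
      ((2 * a - 1) * (|α| + (1 + t₀) * |β| + r * (1 + t₀) * |α|)) ∧
    ‖y' t‖ ≤ (1 + t) ^ (a - 1) * (1 + t₀) ^ (-a) *
      (2 * (2 * a - 1) * (|α| + (1 + t₀) * |β| + r * (1 + t₀) * |α|)) := by
  have hre := kg_real_bounds (y := fun t => (y t).re) (y' := fun t => (y' t).re) ha hr ht₀
    (fun s hs => Complex.reCLM.hasFDerivAt.comp_hasDerivAt s (h s (by linarith)).1)
    (fun s hs => by
      have := Complex.reCLM.hasFDerivAt.comp_hasDerivAt s (h s (by linarith)).2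
      rw [Complex.reCLM_apply, Complex.re_ofReal_mul] at this
      exact this) ht
  have him := kg_real_bounds (y := fun t => (y t).im) (y' := fun t => (y' t).im) ha hr ht₀
    (fun s hs => Complex.imCLM.hasFDerivAt.comp_hasDerivAt s (h s (by linarith)).1)
    (fun s hs => by
      have := Complex.imCLM.hasFDerivAt.comp_hasDerivAt s (h s (by linarith)).2
      rw [Complex.imCLM_apply, Complex.im_ofReal_mul] at this
      exact this) ht
  simp only [hα, hβ, Complex.ofReal_re, Complex.ofReal_im, abs_zero, mul_zero, add_zero] at hre him
  have e1 := Complex.norm_le_abs_re_add_abs_im (y t)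
  have e2 := Complex.norm_le_abs_re_add_abs_im (y' t)
  refine ⟨by linarith [hre.1, him.1], ?_, by linarith [hre.2.2, him.2.2]⟩
  have := mul_le_mul_of_nonneg_left e1 hr.le
  linarith [hre.2.1, him.2.1]

theorem exists_isKGSolution_ePlus {n : ℝ} (hn : ∀ m : ℤ, n ≠ m) {r : ℝ} (hr : 0 < r) :
    ∃ y', IsKGSolution (n ^ 2 - 1 / 4) r (ePlus n r) y' := by
  refine exists_isKGSolution_sqrt_mul_besselJ (fun k hk => hn (-(k + 1)) ?_) hr
  have : ((n + k + 1 : ℝ) : ℂ) = 0 := by push_cast; exact hk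
  have := Complex.ofReal_eq_zero.mp this
  push_cast
  linarith

theorem exists_isKGSolution_eMinus {n : ℝ} (hn : ∀ m : ℤ, n ≠ m) {r : ℝ} (hr : 0 < r) :
    ∃ y', IsKGSolution (n ^ 2 - 1 / 4) r (eMinus n r) y' := by
  obtain ⟨y', hy⟩ := exists_isKGSolution_ePlus hn hr
  obtain ⟨z', hz⟩ := exists_isKGSolution_ePlus (n := -n)
    (fun m hm => hn (-m) (by push_cast; linarith)) hr
  rw [neg_sq] at hz
  refine ⟨_, (hy.linComb hz (Complex.cos (n * (π : ℂ)) / Complex.sin (n * (π : ℂ)))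
    (-1 / Complex.sin (n * (π : ℂ)))).congr fun t _ => ?_⟩
  simp only [eMinus, besselY, ePlus, Complex.ofReal_neg]
  ring

/-- Pointwise bounds for the multipliers `E₀` and `E₁`. -/
theorem propagator_bounds {n r t₀ t : ℝ} (hn : ∀ m : ℤ, n ≠ m) (hn' : 1 / 2 < n) (hr : 0 < r)
    (ht₀ : 0 ≤ t₀) (ht : t₀ ≤ t) :
    (‖E0 n r t t₀‖ ≤ (1 + t) ^ (1 / 2 + n) * (1 + t₀) ^ (-(1 / 2 + n)) * (5 + n) ∧
      r * ‖E0 n r t t₀‖ ≤ (1 + t) ^ (-(1 / 2) + n) * (1 + t₀) ^ (-(1 / 2 + n)) *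
        (4 * n * (1 + r * (1 + t₀))) ∧
      ‖E0dot n r t t₀‖ ≤ (1 + t) ^ (-(1 / 2) + n) * (1 + t₀) ^ (-(1 / 2 + n)) *
        (4 * n * (1 + r * (1 + t₀)))) ∧
    (‖E1 n r t t₀‖ ≤ (1 + t) ^ (1 / 2 + n) * (1 + t₀) ^ (-(1 / 2 + n)) *
        ((5 + n) * (1 + t₀)) ∧
      r * ‖E1 n r t t₀‖ ≤ (1 + t) ^ (-(1 / 2) + n) * (1 + t₀) ^ (-(1 / 2 + n)) *
        (4 * n * (1 + t₀)) ∧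
      ‖E1dot n r t t₀‖ ≤ (1 + t) ^ (-(1 / 2) + n) * (1 + t₀) ^ (-(1 / 2 + n)) *
        (4 * n * (1 + t₀))) := by
  obtain ⟨y', hy⟩ := exists_isKGSolution_ePlus hn hr
  obtain ⟨z', hz⟩ := exists_isKGSolution_eMinus hn hr
  have hs : 0 < 1 + t := by linarith
  have hs₀ : 0 < 1 + t₀ := by linarith
  have hdy : ePlusDot n r t₀ = y' t₀ := (hy t₀ (by linarith)).1.deriv
  have hdz : eMinusDot n r t₀ = z' t₀ := (hz t₀ (by linarith)).1.deriv
  set W := ePlus n r t₀ * eMinusDot n r t₀ - ePlusDot n r t₀ * eMinus n r t₀ with hW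
  have hm : n ^ 2 - 1 / 4 = (1 / 2 + n) * ((1 / 2 + n) - 1) := by ring
  rw [hm] at hy hz
  have h0 : IsKGSolution ((1 / 2 + n) * ((1 / 2 + n) - 1)) r (fun s => E0 n r s t₀)
      (fun s => eMinusDot n r t₀ / W * y' s + -ePlusDot n r t₀ / W * z' s) := by
    refine (hy.linComb hz (eMinusDot n r t₀ / W) (-ePlusDot n r t₀ / W)).congr fun s _ => ?_
    simp only [E0, ← hW]
    ring
  have h1 : IsKGSolution ((1 / 2 + n) * ((1 / 2 + n) - 1)) r (fun s => E1 n r s t₀)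
      (fun s => -eMinus n r t₀ / W * y' s + ePlus n r t₀ / W * z' s) := by
    refine (hy.linComb hz (-eMinus n r t₀ / W) (ePlus n r t₀ / W)).congr fun s _ => ?_
    simp only [E1, ← hW]
    ring
  have hd0 : E0dot n r t t₀ = eMinusDot n r t₀ / W * y' t + -ePlusDot n r t₀ / W * z' t :=
    (h0 t (by linarith)).1.deriv
  have hd1 : E1dot n r t t₀ = -eMinus n r t₀ / W * y' t + ePlus n r t₀ / W * z' t :=
    (h1 t (by linarith)).1.deriv
  by_cases hW0 : W = 0
  · have e0 : E0 n r t t₀ = 0 := by simp only [E0, ← hW, hW0, div_zero]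
    have e1 : E1 n r t t₀ = 0 := by simp only [E1, ← hW, hW0, div_zero]
    rw [hd0, hd1, e0, e1, hW0]
    simp only [div_zero, zero_mul, add_zero, norm_zero, mul_zero]
    refine ⟨⟨?_, ?_, ?_⟩, ?_, ?_, ?_⟩ <;> positivity
  · have b0 := h0.bounds (α := 1) (β := 0) (by linarith) hr ht₀ ht
      (by simp only [E0, ← hW]; rw [div_self hW0]; simp)
      (by rw [hdy, hdz]; push_cast; ring)
    have b1 := h1.bounds (α := 0) (β := 1) (by linarith) hr ht₀ ht
      (by simp only [E1]; simp [mul_comm])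
      (by
        have : -eMinus n r t₀ / W * y' t₀ + ePlus n r t₀ / W * z' t₀ = W / W := by
          rw [← hdy, ← hdz]
          conv_rhs => rw [hW]
          ring
        rw [this, div_self hW0]
        simp)
    rw [← hd0] at b0
    rw [← hd1] at b1
    have ea : 1 / 2 + n - 1 = -(1 / 2) + n := by ring
    have eb : 2 * (1 / 2 + n) - 1 = 2 * n := by ring
    rw [ea, eb] at b0 b1
    simp only [abs_one, abs_zero, mul_zero, add_zero, zero_add, mul_one] at b0 b1
    have hr1 : 0 ≤ r * (1 + t₀) := by positivity
    refine ⟨⟨b0.1.trans ?_, b0.2.1.trans ?_, b0.2.2.trans ?_⟩,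
      b1.1.trans ?_, b1.2.1.trans ?_, b1.2.2.trans ?_⟩ <;>
    refine mul_le_mul_of_nonneg_left ?_ (by positivity) <;> nlinarith

/-- An `L²` bound from an almost everywhere pointwise bound by a combination of `G`. -/
theorem eLpNorm_le_ofReal_mul {d : ℕ} {F : EuclideanSpace ℝ (Fin d) → ℂ}
    {G : EuclideanSpace ℝ (Fin d) → ℝ} {K : ℝ} (hK : 0 ≤ K)
    (h : ∀ᵐ ξ, ‖F ξ‖ ≤ K * G ξ) :
    eLpNorm F 2 volume ≤ ENNReal.ofReal K * eLpNorm G 2 volume := by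
  calc eLpNorm F 2 volume ≤ eLpNorm (fun ξ => K * G ξ) 2 volume := eLpNorm_mono_ae_real h
    _ = ENNReal.ofReal K * eLpNorm G 2 volume := by
      rw [show (fun ξ => K * G ξ) = K • G from rfl, eLpNorm_const_smul,
        Real.enorm_eq_ofReal hK]

theorem stmt18 (d : ℕ) (hd : 1 ≤ d) (μ : ℝ) (hμ : μ < 0)
    (hν : ∀ n : ℤ, Real.sqrt (1 - 4 * μ) / 2 ≠ (n : ℝ)) :
    (∀ t₀ : ℝ, 0 ≤ t₀ → ∃ C > (0 : ℝ), ∀ t : ℝ, t₀ ≤ t →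
      ∀ g₀ g₁ : EuclideanSpace ℝ (Fin d) → ℂ, Measurable g₀ → Measurable g₁ →
        eLpNorm g₀ 2 volume < ⊤ →
        eLpNorm (fun ξ => (‖ξ‖ : ℂ) * g₀ ξ) 2 volume < ⊤ →
        eLpNorm g₁ 2 volume < ⊤ →
        eLpNorm (fun ξ => (‖ξ‖ : ℂ) *
              (E0 (nuOf μ) ‖ξ‖ t t₀ * g₀ ξ + E1 (nuOf μ) ‖ξ‖ t t₀ * g₁ ξ)) 2 volume +
          eLpNorm (fun ξ =>
              E0dot (nuOf μ) ‖ξ‖ t t₀ * g₀ ξ + E1dot (nuOf μ) ‖ξ‖ t t₀ * g₁ ξ) 2 volume ≤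
          ENNReal.ofReal (C * (1 + t) ^ (-(1 / 2) + Real.sqrt (1 - 4 * μ) / 2)) *
            (eLpNorm g₀ 2 volume + eLpNorm (fun ξ => (‖ξ‖ : ℂ) * g₀ ξ) 2 volume +
              eLpNorm g₁ 2 volume)) ∧
    (∃ C' > (0 : ℝ), ∀ t t₀ : ℝ, 0 ≤ t₀ → t₀ ≤ t →
      ∀ g₀ g₁ : EuclideanSpace ℝ (Fin d) → ℂ, Measurable g₀ → Measurable g₁ →
        eLpNorm g₀ 2 volume < ⊤ → eLpNorm g₁ 2 volume < ⊤ →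
        eLpNorm (fun ξ =>
              E0 (nuOf μ) ‖ξ‖ t t₀ * g₀ ξ + E1 (nuOf μ) ‖ξ‖ t t₀ * g₁ ξ) 2 volume ≤
          ENNReal.ofReal (C' * (1 + t) ^ (1 / 2 + Real.sqrt (1 - 4 * μ) / 2) *
              (1 + t₀) ^ (1 / 2 - Real.sqrt (1 - 4 * μ) / 2)) *
            (eLpNorm g₀ 2 volume + eLpNorm g₁ 2 volume)) := by
  have hnu : nuOf μ = ((Real.sqrt (1 - 4 * μ) / 2 : ℝ) : ℂ) := if_pos (by linarith)
  have hn' : 1 / 2 < Real.sqrt (1 - 4 * μ) / 2 := by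
    have : 1 < Real.sqrt (1 - 4 * μ) := Real.lt_sqrt_of_sq_lt (by linarith)
    linarith
  rw [hnu]
  generalize Real.sqrt (1 - 4 * μ) / 2 = n at hν hn'
  have hn0 : 0 < n := by linarith
  have : Nonempty (Fin d) := ⟨⟨0, hd⟩⟩
  have hae : ∀ᵐ ξ : EuclideanSpace ℝ (Fin d), 0 < ‖ξ‖ := by
    filter_upwards [Measure.ae_ne (volume : Measure (EuclideanSpace ℝ (Fin d))) 0] with ξ hξ
    exact norm_pos_iff.mpr hξ
  constructor
  · intro t₀ ht₀
    have hs₀ : 0 < 1 + t₀ := by linarith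
    refine ⟨8 * n * (1 + t₀), by positivity, fun t ht g₀ g₁ hg₀ hg₁ _ _ _ => ?_⟩
    have hs : 0 < 1 + t := by linarith
    set P := (1 + t) ^ (-(1 / 2) + n) with hP
    have hPpos : 0 < P := Real.rpow_pos_of_pos hs _
    have hQ : (1 + t₀) ^ (-(1 / 2 + n)) ≤ 1 :=
      Real.rpow_le_one_of_one_le_of_nonpos (by linarith) (by linarith)
    have hQ0 : 0 < (1 + t₀) ^ (-(1 / 2 + n)) := Real.rpow_pos_of_pos hs₀ _
    set G : EuclideanSpace ℝ (Fin d) → ℝ :=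
      fun ξ => ‖g₀ ξ‖ + ‖(‖ξ‖ : ℂ) * g₀ ξ‖ + ‖g₁ ξ‖ with hG
    set K := 4 * n * (1 + t₀) * P with hK
    have hKpos : 0 ≤ K := by positivity
    have key : ∀ {A B p q r : ℝ}, 0 < r → 0 ≤ p → 0 ≤ q →
        A ≤ P * (1 + t₀) ^ (-(1 / 2 + n)) * (4 * n * (1 + r * (1 + t₀))) →
        B ≤ P * (1 + t₀) ^ (-(1 / 2 + n)) * (4 * n * (1 + t₀)) →
        A * p + B * q ≤ K * (p + r * p + q) := by
      intro A B p q r hr hp hq hA hB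
      have hA' : A ≤ K * (1 + r) := by
        refine hA.trans ?_
        have h1 : P * (1 + t₀) ^ (-(1 / 2 + n)) ≤ P := mul_le_of_le_one_right hPpos.le hQ
        have h2 : 1 + r * (1 + t₀) ≤ (1 + t₀) * (1 + r) := by nlinarith
        calc P * (1 + t₀) ^ (-(1 / 2 + n)) * (4 * n * (1 + r * (1 + t₀)))
            ≤ P * (4 * n * ((1 + t₀) * (1 + r))) := by gcongr
          _ = K * (1 + r) := by rw [hK]; ring
      have hB' : B ≤ K := by
        refine hB.trans ?_
        have h1 : P * (1 + t₀) ^ (-(1 / 2 + n)) ≤ P := mul_le_of_le_one_right hPpos.le hQ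
        calc P * (1 + t₀) ^ (-(1 / 2 + n)) * (4 * n * (1 + t₀))
            ≤ P * (4 * n * (1 + t₀)) := by gcongr
          _ = K := by rw [hK]; ring
      calc A * p + B * q ≤ K * (1 + r) * p + K * q := by gcongr
        _ = _ := by ring
    have b1 := eLpNorm_le_ofReal_mul (F := fun ξ => (‖ξ‖ : ℂ) *
        (E0 n ‖ξ‖ t t₀ * g₀ ξ + E1 n ‖ξ‖ t t₀ * g₁ ξ)) (G := G) hKpos (by
      filter_upwards [hae] with ξ hξ
      obtain ⟨⟨_, h0, _⟩, _, h1, _⟩ := propagator_bounds hν hn' hξ ht₀ ht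
      have := key hξ (norm_nonneg (g₀ ξ)) (norm_nonneg (g₁ ξ)) h0 h1
      simp only [hG, norm_mul, Complex.norm_real, norm_norm]
      refine le_trans ?_ this
      calc ‖ξ‖ * ‖E0 n ‖ξ‖ t t₀ * g₀ ξ + E1 n ‖ξ‖ t t₀ * g₁ ξ‖
          ≤ ‖ξ‖ * (‖E0 n ‖ξ‖ t t₀‖ * ‖g₀ ξ‖ + ‖E1 n ‖ξ‖ t t₀‖ * ‖g₁ ξ‖) := by
            gcongr
            refine (norm_add_le _ _).trans ?_
            rw [norm_mul, norm_mul]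
        _ = _ := by ring)
    have b2 := eLpNorm_le_ofReal_mul (F := fun ξ =>
        E0dot n ‖ξ‖ t t₀ * g₀ ξ + E1dot n ‖ξ‖ t t₀ * g₁ ξ) (G := G) hKpos (by
      filter_upwards [hae] with ξ hξ
      obtain ⟨⟨_, _, h0⟩, _, _, h1⟩ := propagator_bounds hν hn' hξ ht₀ ht
      have := key hξ (norm_nonneg (g₀ ξ)) (norm_nonneg (g₁ ξ)) h0 h1
      simp only [hG, norm_mul, Complex.norm_real, norm_norm]
      refine le_trans ?_ this
      refine (norm_add_le _ _).trans ?_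
      rw [norm_mul, norm_mul])
    have hm : Measurable fun ξ : EuclideanSpace ℝ (Fin d) => (‖ξ‖ : ℂ) * g₀ ξ :=
      (Complex.measurable_ofReal.comp measurable_norm).mul hg₀
    have hGle : eLpNorm G 2 volume ≤ eLpNorm g₀ 2 volume +
        eLpNorm (fun ξ => (‖ξ‖ : ℂ) * g₀ ξ) 2 volume + eLpNorm g₁ 2 volume := by
      refine (eLpNorm_add_le (hg₀.norm.add hm.norm).aestronglyMeasurable
        hg₁.norm.aestronglyMeasurable one_le_two).trans ?_
      refine add_le_add ((eLpNorm_add_le hg₀.norm.aestronglyMeasurable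
        hm.norm.aestronglyMeasurable one_le_two).trans ?_) (eLpNorm_norm _).le
      exact add_le_add (eLpNorm_norm _).le (eLpNorm_norm _).le
    refine (add_le_add b1 b2).trans ?_
    rw [← add_mul, ← ENNReal.ofReal_add hKpos hKpos]
    refine mul_le_mul' (le_of_eq ?_) hGle
    congr 1
    rw [hK]
    ring
  · refine ⟨5 + n, by positivity, fun t t₀ ht₀ ht g₀ g₁ hg₀ hg₁ _ _ => ?_⟩
    have hs₀ : 0 < 1 + t₀ := by linarith
    have hs : 0 < 1 + t := by linarith
    set P := (1 + t) ^ (1 / 2 + n) with hP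
    have hPpos : 0 < P := Real.rpow_pos_of_pos hs _
    have hQ0 : 0 < (1 + t₀) ^ (-(1 / 2 + n)) := Real.rpow_pos_of_pos hs₀ _
    have eQ : (1 + t₀) ^ (1 / 2 - n) = (1 + t₀) ^ (-(1 / 2 + n)) * (1 + t₀) := by
      rw [← Real.rpow_add_one hs₀.ne']; ring_nf
    set G : EuclideanSpace ℝ (Fin d) → ℝ := fun ξ => ‖g₀ ξ‖ + ‖g₁ ξ‖ with hG
    set K := (5 + n) * P * (1 + t₀) ^ (1 / 2 - n) with hK
    have hKpos : 0 ≤ K := by positivity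
    have b := eLpNorm_le_ofReal_mul (F := fun ξ =>
        E0 n ‖ξ‖ t t₀ * g₀ ξ + E1 n ‖ξ‖ t t₀ * g₁ ξ) (G := G) hKpos (by
      filter_upwards [hae] with ξ hξ
      obtain ⟨⟨h0, _, _⟩, h1, _, _⟩ := propagator_bounds hν hn' hξ ht₀ ht
      have h0' : ‖E0 n ‖ξ‖ t t₀‖ ≤ K := by
        refine h0.trans ?_
        rw [hK, eQ]
        have : 0 ≤ P * (1 + t₀) ^ (-(1 / 2 + n)) * (5 + n) * t₀ := by positivity
        nlinarith
      have h1' : ‖E1 n ‖ξ‖ t t₀‖ ≤ K := by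
        refine h1.trans (le_of_eq ?_)
        rw [hK, eQ]
        ring
      refine (norm_add_le _ _).trans ?_
      rw [norm_mul, norm_mul, hG, mul_add]
      gcongr)
    refine b.trans (mul_le_mul' le_rfl ?_)
    refine (eLpNorm_add_le hg₀.norm.aestronglyMeasurable
      hg₁.norm.aestronglyMeasurable one_le_two).trans ?_
    exact add_le_add (eLpNorm_norm _).le (eLpNorm_norm _).le

end
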